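/- arXiv:2605.13824 — 5 statements merged into one kernel-verified Lean document; each statement's English description precedes it below -/
import Mathlib

section
/- Let G be a group, K ≤ G a subgroup, Z ≤ G a subgroup contained in the center of G, and Δ ∈ G. Then K·Z is a subgroup of G, and the map sending the left coset g·K (for g ∈ K·Δ·K) to the left coset g·(K·Z) is a well-defined surjection from the set of left K-cosets contained in K·Δ·K onto the set of left (K·Z)-cosets contained in K·Δ·K·Z. This map is bijective if and only if (Δ K Δ⁻¹)·Z ∩ K = (Δ K Δ⁻¹) ∩ K. -/
open Pointwise

/-- For a group `G`, a subgroup `K`, a central subgroup `Z`, and `Δ ∈ G`: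
`K·Z` is a subgroup; the map `g·K ↦ g·(K·Z)` is a well-defined surjection from the set of
left `K`-cosets contained in `K·Δ·K` onto the set of left `K·Z`-cosets contained in
`K·Δ·K·Z`; and it is bijective iff `(Δ K Δ⁻¹)·Z ∩ K = (Δ K Δ⁻¹) ∩ K`. -/
theorem stmt_9 {G : Type} [Group G] (K Z : Subgroup G) (hZ : Z ≤ Subgroup.center G) (Δ : G)
    (D KZ : Set G)
    (hD : D = (K : Set G) * {Δ} * (K : Set G))
    (hKZ : KZ = (K : Set G) * (Z : Set G)) :
    -- K·Z is a subgroup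
    (∃ KZgrp : Subgroup G, (KZgrp : Set G) = KZ) ∧
    -- well-definedness of g·K ↦ g·(K·Z)
    (∀ g ∈ D, ∀ g' ∈ D, g • (K : Set G) = g' • (K : Set G) → g • KZ = g' • KZ) ∧
    -- surjectivity onto the left (K·Z)-cosets contained in K·Δ·K·Z
    (∀ h ∈ D * (Z : Set G), ∃ g ∈ D, g • KZ = h • KZ) ∧
    -- bijectivity criterion
    ((∀ g ∈ D, ∀ g' ∈ D, g • KZ = g' • KZ → g • (K : Set G) = g' • (K : Set G)) ↔
      {g : G | ∃ k ∈ K, g = Δ * k * Δ⁻¹} * (Z : Set G) ∩ (K : Set G)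
        = {g : G | ∃ k ∈ K, g = Δ * k * Δ⁻¹} ∩ (K : Set G)) := by
  have hcomm : ∀ z ∈ Z, ∀ g : G, g * z = z * g := fun z hz =>
    Subgroup.mem_center_iff.mp (hZ hz)
  have : Z.Normal := ⟨fun z hz g => by rwa [hcomm z hz g, mul_inv_cancel_right]⟩
  have hsup : KZ = ((K ⊔ Z : Subgroup G) : Set G) := by rw [hKZ, Subgroup.mul_normal]
  have hmem : ∀ x, x ∈ K ⊔ Z ↔ ∃ k ∈ K, ∃ z ∈ Z, k * z = x := fun x => by
    rw [← SetLike.mem_coe, ← hsup, hKZ, Set.mem_mul]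
    rfl
  have hD' : ∀ x, x ∈ D ↔ ∃ a ∈ K, ∃ b ∈ K, a * Δ * b = x := fun x => by
    simp [hD, Set.mem_mul, -Set.mul_singleton, -Set.image_mul_right]
  simp only [hsup, leftCoset_eq_iff]
  refine ⟨⟨K ⊔ Z, rfl⟩, fun g _ g' _ h => le_sup_left (a := K) h, ?_, fun hinj => ?_,
    fun heq g hg g' hg' h => ?_⟩
  · rintro _ ⟨d, hd, z, hz, rfl⟩
    refine ⟨d, hd, le_sup_right (a := K) ?_⟩
    simpa using hz
  · refine Set.Subset.antisymm ?_ ?_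
    · rintro _ ⟨⟨_, ⟨k, hk, rfl⟩, z, hz, rfl⟩, hx⟩
      have hx' : Δ * k * Δ⁻¹ * z ∈ K := hx
      have hconj : Δ⁻¹ * (Δ * k * Δ⁻¹ * z * Δ) = k * z := by
        rw [mul_assoc _ z, ← hcomm z hz Δ]
        group
      have hkz := hinj Δ ((hD' _).mpr ⟨1, K.one_mem, 1, K.one_mem, by simp⟩)
        (Δ * k * Δ⁻¹ * z * Δ) ((hD' _).mpr ⟨_, hx', 1, K.one_mem, by simp⟩)
        (by rw [hconj]; exact (hmem _).mpr ⟨k, hk, z, hz, rfl⟩)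
      exact ⟨⟨_, hkz, by group⟩, hx⟩
    · rintro x ⟨hx, hxK⟩
      exact ⟨⟨x, hx, 1, Z.one_mem, mul_one x⟩, hxK⟩
  · obtain ⟨a, ha, b, hb, rfl⟩ := (hD' g).mp hg
    obtain ⟨a', ha', b', hb', rfl⟩ := (hD' g').mp hg'
    obtain ⟨k, hk, z, hz, hkz⟩ := (hmem _).mp h
    have hxK : a⁻¹ * a' ∈ K := K.mul_mem (K.inv_mem ha) ha'
    have hx : Δ * (b * k * b'⁻¹) * Δ⁻¹ * z = a⁻¹ * a' := by
      calc Δ * (b * k * b'⁻¹) * Δ⁻¹ * z = Δ * b * k * ((b'⁻¹ * Δ⁻¹) * z) := by group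
        _ = Δ * b * (k * z) * (b'⁻¹ * Δ⁻¹) := by rw [hcomm z hz]; group
        _ = a⁻¹ * a' := by rw [hkz]; group
    obtain ⟨⟨c, hc, hac⟩, -⟩ := heq.subset
      ⟨⟨_, ⟨_, K.mul_mem (K.mul_mem hb hk) (K.inv_mem hb'), rfl⟩, z, hz, hx⟩, hxK⟩
    have hfactor : (a * Δ * b)⁻¹ * (a' * Δ * b') = b⁻¹ * c * b' := by
      calc (a * Δ * b)⁻¹ * (a' * Δ * b') = b⁻¹ * Δ⁻¹ * (a⁻¹ * a') * Δ * b' := by group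
        _ = b⁻¹ * c * b' := by rw [hac]; group
    rw [hfactor]
    exact K.mul_mem (K.mul_mem (K.inv_mem hb) hc) hb'
end

section
/- Let G be a group, T ≤ G an abelian subgroup, U ≤ G a subgroup normalized by T, H ≤ G a subgroup, and S ≤ T a subgroup. Then for every τ ∈ G, t₀ ∈ T, u₀ ∈ U, and h₀ ∈ H, one has S ∩ (t₀u₀τh₀)·H·(t₀u₀τh₀)⁻¹·U = S ∩ τ·H·τ⁻¹·U, where X·U denotes the set product {x·u : x ∈ X, u ∈ U}. In other words, the subset S ∩ τHτ⁻¹U of S depends only on the double coset (TU)·τ·H of τ. -/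
/-- If `T` is abelian and normalizes `U`, then conjugating `x` by an element of `TU` does not change
which left cosets `sU` with `s ∈ T` it represents. -/
theorem conj_inv_mul_mem_iff {G : Type*} [Group G] {T U : Subgroup G}
    (hT : ∀ a ∈ T, ∀ b ∈ T, a * b = b * a) (hTU : ∀ t ∈ T, ∀ u ∈ U, t * u * t⁻¹ ∈ U)
    {t u s : G} (ht : t ∈ T) (hu : u ∈ U) (hs : s ∈ T) (x : G) :
    (t * u * x * (t * u)⁻¹)⁻¹ * s ∈ U ↔ x⁻¹ * s ∈ U := by
  have key : (t * u * x * (t * u)⁻¹)⁻¹ * s = t * (u * (x⁻¹ * s) * (s⁻¹ * u⁻¹ * s)) * t⁻¹ := by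
    have hcomm : t⁻¹ * s = s * t⁻¹ := hT _ (T.inv_mem ht) _ hs
    simp [mul_assoc, hcomm]
  have conj_mem_iff (y : G) : t * y * t⁻¹ ∈ U ↔ y ∈ U :=
    ⟨fun h ↦ by simpa [mul_assoc] using hTU _ (T.inv_mem ht) _ h, hTU t ht y⟩
  have hsu : s⁻¹ * u⁻¹ * s ∈ U := by simpa using hTU _ (T.inv_mem hs) _ (U.inv_mem hu)
  rw [key, conj_mem_iff, U.mul_mem_cancel_right hsu, U.mul_mem_cancel_left hu]

/-- Membership in the product set `(xHx⁻¹)U`, expressed without reference to the factor in `U`. -/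
theorem exists_conj_mul_eq_iff {G : Type*} [Group G] (U H : Subgroup G) (x g : G) :
    (∃ h ∈ H, ∃ u ∈ U, g = x * h * x⁻¹ * u) ↔ ∃ h ∈ H, (x * h * x⁻¹)⁻¹ * g ∈ U := by
  refine exists_congr fun h ↦ and_congr_right fun _ ↦ ⟨?_, fun hg ↦ ⟨_, hg, by group⟩⟩
  rintro ⟨u, hu, rfl⟩
  rwa [inv_mul_cancel_left]

/-- Let `T` be an abelian subgroup of `G`, `U` a subgroup normalized
by `T`, `H` a subgroup, and `S ≤ T`. Then for all `τ ∈ G`, `t₀ ∈ T`, `u₀ ∈ U`, `h₀ ∈ H`,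
`S ∩ (t₀u₀τh₀)·H·(t₀u₀τh₀)⁻¹·U = S ∩ τ·H·τ⁻¹·U`; i.e. `S ∩ τHτ⁻¹U` depends only on the
double coset `(TU)·τ·H`. -/
theorem stmt_11 {G : Type} [Group G] (T U H S : Subgroup G)
    (hT : ∀ a ∈ T, ∀ b ∈ T, a * b = b * a)
    (hTU : ∀ t ∈ T, ∀ u ∈ U, t * u * t⁻¹ ∈ U)
    (hS : S ≤ T)
    (τ t₀ u₀ h₀ : G) (ht₀ : t₀ ∈ T) (hu₀ : u₀ ∈ U) (hh₀ : h₀ ∈ H) :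
    (S : Set G) ∩ {g : G | ∃ h ∈ H, ∃ u ∈ U,
        g = (t₀ * u₀ * τ * h₀) * h * (t₀ * u₀ * τ * h₀)⁻¹ * u}
      = (S : Set G) ∩ {g : G | ∃ h ∈ H, ∃ u ∈ U, g = τ * h * τ⁻¹ * u} := by
  ext s
  refine and_congr_right fun hs ↦ ?_
  simp only [Set.mem_ofPred_eq, exists_conj_mul_eq_iff]
  have conj_eq (h : G) : t₀ * u₀ * τ * h₀ * h * (t₀ * u₀ * τ * h₀)⁻¹ =
      t₀ * u₀ * (τ * (h₀ * h * h₀⁻¹) * τ⁻¹) * (t₀ * u₀)⁻¹ := by group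
  simp only [conj_eq, conj_inv_mul_mem_iff hT hTU ht₀ hu₀ (hS hs)]
  constructor
  · rintro ⟨h, hh, hU⟩
    exact ⟨h₀ * h * h₀⁻¹, H.mul_mem (H.mul_mem hh₀ hh) (H.inv_mem hh₀), hU⟩
  · rintro ⟨h, hh, hU⟩
    refine ⟨h₀⁻¹ * h * h₀, H.mul_mem (H.mul_mem (H.inv_mem hh₀) hh) hh₀, ?_⟩
    simpa [mul_assoc] using hU
end

section
/- Let F be a field and n ≥ 1. Let H ≤ GL_n(F) be a subgroup every element h of which is unipotent, i.e., (h − I_n)^n = 0. Let τ ∈ GL_n(F), let U ≤ GL_n(F) be the subgroup of upper triangular matrices all of whose diagonal entries equal 1, and let t ∈ GL_n(F) be an invertible diagonal matrix. If t ∈ (τ·H·τ⁻¹)·U, i.e., t = (τhτ⁻¹)·u for some h ∈ H and u ∈ U, then t = I_n. -/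
open Matrix

theorem Matrix.BlockTriangular.mul_apply_self {m R : Type*} [Fintype m] [LinearOrder m]
    [NonUnitalNonAssocSemiring R] {M N : Matrix m m R}
    (hM : M.BlockTriangular id) (hN : N.BlockTriangular id) (i : m) :
    (M * N) i i = M i i * N i i := by
  rw [Matrix.mul_apply]
  refine Finset.sum_eq_single i (fun j _ hj => ?_) (by simp)
  rcases lt_or_gt_of_ne hj with h | h
  · rw [hM h, zero_mul]
  · rw [hN h, mul_zero]

theorem Matrix.BlockTriangular.pow_apply_self {m R : Type*} [Fintype m] [LinearOrder m]
    [Semiring R] {M : Matrix m m R} (hM : M.BlockTriangular id) (k : ℕ) (i : m) :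
    (M ^ k) i i = M i i ^ k := by
  induction k with
  | zero => simp
  | succ k ih => rw [pow_succ, (hM.pow k).mul_apply_self hM, ih, pow_succ]

theorem Units.conj_sub_one_pow {R : Type*} [Ring R] (a b : Rˣ) (k : ℕ) :
    (((a * b * a⁻¹ : Rˣ) : R) - 1) ^ k = a * ((b : R) - 1) ^ k * (a⁻¹ : Rˣ) := by
  rw [← Units.conj_pow]
  simp [mul_sub, sub_mul]

/-- Let `H ≤ GL_n(F)` consist of unipotent matrices, `τ ∈ GL_n(F)`,
`u` upper unitriangular and `t` an invertible diagonal matrix. If `t = (τhτ⁻¹)·u` with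
`h ∈ H`, then `t = 1`. -/
theorem stmt_12 {F : Type} [Field F] (n : ℕ) (hn : 1 ≤ n)
    (H : Subgroup ((Matrix (Fin n) (Fin n) F)ˣ))
    (hH : ∀ h : (Matrix (Fin n) (Fin n) F)ˣ, h ∈ H →
      ((h : Matrix (Fin n) (Fin n) F) - 1) ^ n = 0)
    (τ t u h : (Matrix (Fin n) (Fin n) F)ˣ)
    (ht : ∀ i j : Fin n, i ≠ j → (t : Matrix (Fin n) (Fin n) F) i j = 0)
    (hu : ∀ i j : Fin n,
      ((j : ℕ) < (i : ℕ) → (u : Matrix (Fin n) (Fin n) F) i j = 0) ∧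
      (i = j → (u : Matrix (Fin n) (Fin n) F) i j = 1))
    (hh : h ∈ H)
    (heq : t = τ * h * τ⁻¹ * u) : t = 1 := by
  obtain ⟨d, hd⟩ : ∃ d, (t : Matrix (Fin n) (Fin n) F) = diagonal d :=
    ⟨_, ((isDiag_iff_diagonal_diag _).1 fun i j hij => ht i j hij).symm⟩
  have hd0 (i : Fin n) : d i ≠ 0 := by
    have := (Matrix.isUnit_diagonal.1 (hd ▸ t.isUnit) : IsUnit d)
    exact (Pi.isUnit_iff.1 this i).ne_zero
  have hinv : ((t⁻¹ : (Matrix (Fin n) (Fin n) F)ˣ) : Matrix (Fin n) (Fin n) F) =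
      diagonal fun i => (d i)⁻¹ := by
    apply Units.inv_eq_of_mul_eq_one_right
    rw [hd, diagonal_mul_diagonal, ← diagonal_one]
    congr 1
    ext i
    exact mul_inv_cancel₀ (hd0 i)
  have hconj : u * t⁻¹ = τ * h⁻¹ * τ⁻¹ := by rw [heq]; group
  have hpow : (((u * t⁻¹ : (Matrix (Fin n) (Fin n) F)ˣ) : Matrix (Fin n) (Fin n) F) - 1) ^ n
      = 0 := by
    rw [hconj, Units.conj_sub_one_pow, hH _ (H.inv_mem hh), mul_zero, zero_mul]
  rw [Units.val_mul, hinv] at hpow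
  have hu' : (u : Matrix (Fin n) (Fin n) F).BlockTriangular id := fun i j hij => (hu i j).1 hij
  have hdiag (i : Fin n) : d i = 1 := by
    have hi := congrFun (congrFun hpow i) i
    rw [((hu'.mul (blockTriangular_diagonal _)).sub blockTriangular_one).pow_apply_self,
      Matrix.sub_apply, Matrix.mul_diagonal, (hu i i).2 rfl, one_mul, one_apply_eq] at hi
    exact inv_eq_one.1 (sub_eq_zero.1 (eq_zero_of_pow_eq_zero hi))
  ext1
  rw [hd, Units.val_one, ← diagonal_one]
  exact congrArg diagonal (funext hdiag)
end

section
/- Let R be a commutative ring and k ⊆ R a subring which is a field. In GL_2(R), let Z := {x·I₂ : x ∈ R^×} (scalar matrices), U := {(1, u; 0, 1) : u ∈ R} (upper unitriangular matrices), and T_k := {diag(p, r) : p, r ∈ k^×} (diagonal matrices with entries in k^×). For a ∈ R^× write w(a) := (0, a; 1, 0). Then: (a) for a, b ∈ R^×, the matrices w(a) and w(b) lie in the same double coset Z·U·g·T_k·U (i.e., w(a) ∈ Z·U·w(b)·T_k·U) if and only if a·b⁻¹ lies in the image of k^× in R^×; (b) every g ∈ GL_2(R) whose (2,1)-entry is a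 unit of R lies in Z·U·w(a)·U for some a ∈ R^×. -/
open Matrix

/-- The Bruhat-cell product `x · (1, u; 0, 1) · (0, b; 1, 0) · diag(p, q) · (1, v; 0, 1)`. -/
theorem bruhat_product {R : Type*} [CommRing R] (x u b p q v : R) :
    x • (1 : Matrix (Fin 2) (Fin 2) R) * !![1, u; 0, 1] * !![0, b; 1, 0] * !![p, 0; 0, q] *
      !![1, v; 0, 1] = !![x * u * p, x * (u * p * v + b * q); x * p, x * p * v] := by
  ext i j
  fin_cases i <;> fin_cases j <;> simp [Matrix.mul_apply, Fin.sum_univ_two]; ring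

/-- In `GL₂(R)` with `Z` the scalar matrices, `U` the upper
unitriangular matrices, `T_k` the diagonal matrices with entries in `k^×` (`k ⊆ R` a
subring which is a field), and `w(a) = (0, a; 1, 0)` for `a ∈ R^×`:
(a) `w(a) ∈ Z·U·w(b)·T_k·U ↔ a·b⁻¹` lies in the image of `k^×`;
(b) every invertible `g` with unit `(2,1)`-entry lies in `Z·U·w(a)·U` for some `a ∈ R^×`. -/
theorem stmt_13 {R : Type} [CommRing R] (k : Subring R) (hk : IsField k)
    (Z U Tk : Set (Matrix (Fin 2) (Fin 2) R))
    (hZ : Z = {M | ∃ x : Rˣ, M = (x : R) • (1 : Matrix (Fin 2) (Fin 2) R)})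
    (hU : U = {M | ∃ u : R, M = !![1, u; 0, 1]})
    (hTk : Tk = {M | ∃ p q : R, p ∈ k ∧ q ∈ k ∧ p ≠ 0 ∧ q ≠ 0 ∧ M = !![p, 0; 0, q]})
    (w : Rˣ → Matrix (Fin 2) (Fin 2) R) (hw : ∀ a : Rˣ, w a = !![0, (a : R); 1, 0]) :
    -- (a)
    (∀ a b : Rˣ,
      (∃ z ∈ Z, ∃ u ∈ U, ∃ t ∈ Tk, ∃ u' ∈ U, w a = z * u * w b * t * u')
        ↔ ∃ c : R, c ∈ k ∧ c ≠ 0 ∧ (a : R) = c * (b : R)) ∧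
    -- (b)
    (∀ g : Matrix (Fin 2) (Fin 2) R, IsUnit g → IsUnit (g 1 0) →
      ∃ a : Rˣ, ∃ z ∈ Z, ∃ u ∈ U, ∃ u' ∈ U, g = z * u * w a * u') := by
  subst hZ hU hTk
  have hone : (1 : R) ≠ 0 := fun h => by
    obtain ⟨x, y, hxy⟩ := hk.exists_pair_ne
    exact hxy (Subtype.ext (by rw [← mul_one (x : R), ← mul_one (y : R), h, mul_zero, mul_zero]))
  refine ⟨fun a b => ⟨?_, ?_⟩, fun g hg hg' => ?_⟩
  · rintro ⟨_, ⟨x, rfl⟩, _, ⟨u, rfl⟩, _, ⟨p, q, hp, hq, hp0, hq0, rfl⟩, _, ⟨v, rfl⟩, h⟩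
    rw [hw, hw, bruhat_product] at h
    have h01 : (a : R) = x * (u * p * v + b * q) := congrFun (congrFun h 0) 1
    have h10 : 1 = (x : R) * p := congrFun (congrFun h 1) 0
    have h11 : 0 = (x : R) * p * v := congrFun (congrFun h 1) 1
    rw [← h10, one_mul] at h11
    obtain ⟨⟨p', hp'⟩, hpp'⟩ := hk.mul_inv_cancel (a := ⟨p, hp⟩) fun h =>
      hp0 (congrArg Subtype.val h)
    have hpp : p * p' = 1 := congrArg Subtype.val hpp'
    have hx : (x : R) = p' := by linear_combination (-(x : R)) * hpp - p' * h10
    refine ⟨p' * q, k.mul_mem hp' hq, fun h => hq0 ?_, ?_⟩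
    · linear_combination p * h - q * hpp
    · rw [h01, ← h11, hx]
      ring
  · rintro ⟨c, hc, hc0, hac⟩
    refine ⟨_, ⟨1, rfl⟩, _, ⟨0, rfl⟩, _, ⟨1, c, k.one_mem, hc, hone, hc0, rfl⟩, _, ⟨0, rfl⟩, ?_⟩
    rw [hw, hw, bruhat_product, hac]
    simp [mul_comm]
  · obtain ⟨x, hx⟩ := hg'
    obtain ⟨d, hd⟩ := (Matrix.isUnit_iff_isUnit_det g).mp hg
    rw [Matrix.det_fin_two, ← hx] at hd
    have hxi : (x : R) * (x⁻¹ : Rˣ) = 1 := x.mul_inv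
    refine ⟨-d * x⁻¹ * x⁻¹, _, ⟨x, rfl⟩, _, ⟨(x⁻¹ : Rˣ) * g 0 0, rfl⟩, _,
      ⟨(x⁻¹ : Rˣ) * g 1 1, rfl⟩, ?_⟩
    have h := bruhat_product (x : R) ((x⁻¹ : Rˣ) * g 0 0) (-d * x⁻¹ * x⁻¹ : Rˣ) 1 1
      ((x⁻¹ : Rˣ) * g 1 1)
    rw [← Matrix.one_fin_two, mul_one] at h
    rw [hw, h, Matrix.eta_fin_two g, ← hx]
    ext i j
    fin_cases i <;> fin_cases j <;> simp [hd]
    generalize ((x⁻¹ : Rˣ) : R) = y at hxi ⊢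
    linear_combination (-(g 0 1) * (1 + x * y)) * hxi
end

section
/- Let F ⊆ E be an extension of finite fields with |F| = q and |E| = q^r, let d ≥ 1, and let R := E[X]/(X^d). In GL_2(R), let Z := {x·I₂ : x ∈ R^×}, U := {(1, u; 0, 1) : u ∈ R}, and T_F := {diag(p, r) : p, r ∈ F^×}. Then the number of double cosets Z·U·g·T_F·U with g ∈ GL_2(R) that contain at least one matrix whose (2,1)-entry is a unit of R equals (q^r − 1)·q^{r(d−1)}/(q − 1). Equivalently, the map a ↦ [double coset of (0, a; 1, 0)] induces a bijection from R^×/F^× onto this set of double cosets, and |R^×/F^×| = (q^r − 1)·q^{r(d−1)}/(q − 1). -/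
open Matrix

set_option maxHeartbeats 1000000
set_option synthInstance.maxHeartbeats 200000

/-- The finite local ring `R = E[X]/(X^d)`. -/
abbrev QRing (E : Type) [Field E] (d : ℕ) : Type :=
  Polynomial E ⧸ Ideal.span {(Polynomial.X : Polynomial E) ^ d}

/-- The double coset `Z·U·g·T·U` in `2 × 2` matrices over `R`, with `Z` the unit scalars, `U` the
upper unipotents and `T` the diagonal matrices with entries in `f(Fˣ)`. -/
def borelDoubleCoset {F R : Type*} [Field F] [CommRing R] (f : F →+* R)
    (g : Matrix (Fin 2) (Fin 2) R) : Set (Matrix (Fin 2) (Fin 2) R) :=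
  {M | ∃ z ∈ {M | ∃ x : Rˣ, M = !![(x : R), 0; 0, (x : R)]},
    ∃ u ∈ {M | ∃ u : R, M = !![1, u; 0, 1]},
    ∃ t ∈ {M | ∃ p s : Fˣ, M = !![f (p : F), 0; 0, f (s : F)]},
    ∃ u' ∈ {M | ∃ u : R, M = !![1, u; 0, 1]}, M = z * u * g * t * u'}

section DoubleCoset

variable {F R : Type*} [Field F] [CommRing R] {f : F →+* R}

lemma scalar_mul_unipotent_mul_diagonal_mul_unipotent (g : Matrix (Fin 2) (Fin 2) R)
    (x u p s u' : R) :
    !![x, 0; 0, x] * !![1, u; 0, 1] * g * !![p, 0; 0, s] * !![1, u'; 0, 1] =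
      !![x * p * (g 0 0 + u * g 1 0),
          x * (p * u' * (g 0 0 + u * g 1 0) + s * (g 0 1 + u * g 1 1));
        x * p * g 1 0, x * (p * u' * g 1 0 + s * g 1 1)] := by
  conv_lhs => rw [Matrix.eta_fin_two g]
  simp only [Matrix.mul_fin_two]
  congr! 3 <;> ring_nf

lemma mem_borelDoubleCoset {g M : Matrix (Fin 2) (Fin 2) R} :
    M ∈ borelDoubleCoset f g ↔ ∃ (x : Rˣ) (u : R) (p s : Fˣ) (u' : R),
      M = !![(x : R), 0; 0, (x : R)] * !![1, u; 0, 1] * g *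
        !![f (p : F), 0; 0, f (s : F)] * !![1, u'; 0, 1] := by
  constructor
  · rintro ⟨_, ⟨x, rfl⟩, _, ⟨u, rfl⟩, _, ⟨p, s, rfl⟩, _, ⟨u', rfl⟩, h⟩
    exact ⟨x, u, p, s, u', h⟩
  · rintro ⟨x, u, p, s, u', h⟩
    exact ⟨_, ⟨x, rfl⟩, _, ⟨u, rfl⟩, _, ⟨p, s, rfl⟩, _, ⟨u', rfl⟩, h⟩

lemma exists_apply_one_zero_eq_of_mem_borelDoubleCoset {g M : Matrix (Fin 2) (Fin 2) R}
    (h : M ∈ borelDoubleCoset f g) :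
    ∃ (x : Rˣ) (p s : Fˣ), M 1 0 = x * f p * g 1 0 ∧ M.det = x ^ 2 * f p * f s * g.det := by
  obtain ⟨x, u, p, s, u', rfl⟩ := mem_borelDoubleCoset.1 h
  refine ⟨x, p, s, ?_, ?_⟩
  · rw [scalar_mul_unipotent_mul_diagonal_mul_unipotent]
    rfl
  · simp only [Matrix.det_mul, Matrix.det_fin_two_of]
    ring

/-- On the locus of unit `(2,1)`-entry, `det / (M 1 0) ^ 2` modulo `f(Fˣ)` is a complete invariant
of double cosets. -/
lemma mem_borelDoubleCoset_iff_of_isUnit {g M : Matrix (Fin 2) (Fin 2) R} (hg : IsUnit (g 1 0)) :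
    M ∈ borelDoubleCoset f g ↔
      IsUnit (M 1 0) ∧ ∃ c : Fˣ, M.det * g 1 0 ^ 2 = f c * g.det * M 1 0 ^ 2 := by
  constructor
  · intro h
    obtain ⟨x, p, s, h1, h2⟩ := exists_apply_one_zero_eq_of_mem_borelDoubleCoset h
    refine ⟨h1 ▸ (x.isUnit.mul (p.isUnit.map f)).mul hg, s * p⁻¹, ?_⟩
    have hp : f (p : F) * f ((p⁻¹ : Fˣ) : F) = 1 := by rw [← map_mul]; simp
    rw [h1, h2, Units.val_mul, map_mul]
    linear_combination (-(x : R) ^ 2 * f p * f s * g.det * g 1 0 ^ 2) * hp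
  · rintro ⟨hM, c, hc⟩
    obtain ⟨x, hx⟩ : ∃ x : Rˣ, M 1 0 = x * g 1 0 :=
      ⟨hM.unit * hg.unit⁻¹, by simp [mul_assoc]⟩
    have hxu : ∀ y : R, ∃ v : R, y = x * (v * g 1 0) := fun y =>
      ⟨y * (x⁻¹ : Rˣ) * (hg.unit⁻¹ : Rˣ), by simp [mul_assoc, mul_left_comm (x : R) y]⟩
    obtain ⟨u, hu⟩ := hxu (M 0 0 - x * g 0 0)
    obtain ⟨u', hu'⟩ := hxu (M 1 1 - x * (f c * g 1 1))
    rw [sub_eq_iff_eq_add'] at hu hu'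
    refine mem_borelDoubleCoset.2 ⟨x, u, 1, c, u', ?_⟩
    rw [scalar_mul_unipotent_mul_diagonal_mul_unipotent, Matrix.eta_fin_two M, hu, hu', hx]
    have h01 : M 0 1 = x * (u' * (g 0 0 + u * g 1 0) + f c * (g 0 1 + u * g 1 1)) := by
      refine ((x.isUnit.mul hg).mul (hg.pow 2)).mul_left_cancel ?_
      rw [Matrix.det_fin_two, Matrix.det_fin_two, hu, hu', hx] at hc
      linear_combination -hc
    rw [h01]
    simp [mul_add, add_comm]

lemma borelDoubleCoset_eq_iff_of_isUnit {g h : Matrix (Fin 2) (Fin 2) R} (hg : IsUnit (g 1 0))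
    (hh : IsUnit (h 1 0)) :
    borelDoubleCoset f g = borelDoubleCoset f h ↔
      ∃ c : Fˣ, g.det * h 1 0 ^ 2 = f c * h.det * g 1 0 ^ 2 := by
  constructor
  · intro e
    have : g ∈ borelDoubleCoset f g :=
      (mem_borelDoubleCoset_iff_of_isUnit hg).2 ⟨hg, 1, by simp⟩
    rw [e] at this
    exact ((mem_borelDoubleCoset_iff_of_isUnit hh).1 this).2
  · rintro ⟨c, hc⟩
    have hcc : f (c : F) * f ((c⁻¹ : Fˣ) : F) = 1 := by rw [← map_mul]; simp
    ext M
    rw [mem_borelDoubleCoset_iff_of_isUnit hg, mem_borelDoubleCoset_iff_of_isUnit hh]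
    refine and_congr_right fun _ => ⟨?_, ?_⟩
    · rintro ⟨e, he⟩
      refine ⟨e * c, (hg.pow 2).mul_left_cancel ?_⟩
      rw [Units.val_mul, map_mul]
      linear_combination h 1 0 ^ 2 * he + f e * M 1 0 ^ 2 * hc
    · rintro ⟨e, he⟩
      refine ⟨e * c⁻¹, (hh.pow 2).mul_left_cancel ?_⟩
      rw [Units.val_mul, map_mul]
      linear_combination g 1 0 ^ 2 * he - f e * f ((c⁻¹ : Fˣ) : F) * M 1 0 ^ 2 * hc
        - f e * h.det * M 1 0 ^ 2 * g 1 0 ^ 2 * hcc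

lemma borelDoubleCoset_antidiagonal_eq_iff (a b : Rˣ) :
    borelDoubleCoset f !![0, (a : R); 1, 0] = borelDoubleCoset f !![0, (b : R); 1, 0] ↔
      ∃ c : Fˣ, (a : R) = f c * b := by
  rw [borelDoubleCoset_eq_iff_of_isUnit (by simp) (by simp)]
  simp [Matrix.det_fin_two]

lemma setOf_borelDoubleCoset_eq_range :
    {S | ∃ g : Matrix (Fin 2) (Fin 2) R, IsUnit g ∧ S = borelDoubleCoset f g ∧
      ∃ m ∈ S, IsUnit (m 1 0)} =
      Set.range fun a : Rˣ => borelDoubleCoset f !![0, (a : R); 1, 0] := by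
  ext S
  constructor
  · rintro ⟨g, hg, rfl, m, hm, hu⟩
    obtain ⟨x, p, -, h1, -⟩ := exists_apply_one_zero_eq_of_mem_borelDoubleCoset hm
    have hg0 : IsUnit (g 1 0) := isUnit_of_mul_isUnit_right (h1 ▸ hu)
    obtain ⟨y, hy⟩ := hg0
    obtain ⟨D, hD⟩ := (Matrix.isUnit_iff_isUnit_det _).1 hg
    refine ⟨-D * (y ^ 2)⁻¹, ?_⟩
    dsimp only
    rw [borelDoubleCoset_eq_iff_of_isUnit (by simp) ⟨y, hy⟩]
    refine ⟨1, ?_⟩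
    rw [← hy, ← hD]
    simp [Matrix.det_fin_two, mul_assoc, ← mul_pow]
  · rintro ⟨a, rfl⟩
    refine ⟨_, ?_, rfl, !![0, (a : R); 1, 0], ?_, by simp⟩
    · rw [Matrix.isUnit_iff_isUnit_det]
      simp [Matrix.det_fin_two]
    · rw [mem_borelDoubleCoset_iff_of_isUnit (by simp)]
      exact ⟨by simp, 1, by simp⟩

lemma ncard_setOf_borelDoubleCoset :
    {S | ∃ g : Matrix (Fin 2) (Fin 2) R, IsUnit g ∧ S = borelDoubleCoset f g ∧
      ∃ m ∈ S, IsUnit (m 1 0)}.ncard = Nat.card (Rˣ ⧸ (Units.map f.toMonoidHom).range) := by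
  rw [setOf_borelDoubleCoset_eq_range, ← Nat.card_coe_set_eq,
    ← Nat.card_congr (Setoid.quotientKerEquivRange _)]
  refine Nat.card_congr (Quotient.congr (Equiv.refl _) fun a b => ?_)
  rw [Setoid.ker_def, borelDoubleCoset_antidiagonal_eq_iff]
  change _ ↔ QuotientGroup.leftRel _ a b
  rw [QuotientGroup.leftRel_apply]
  constructor
  · rintro ⟨c, hc⟩
    refine ⟨c⁻¹, ?_⟩
    rw [map_inv, inv_eq_iff_eq_inv, _root_.mul_inv_rev, inv_inv, eq_inv_mul_iff_mul_eq]
    ext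
    simp [hc, mul_comm]
  · rintro ⟨c, hc⟩
    refine ⟨c⁻¹, ?_⟩
    have : a = (Units.map f.toMonoidHom) c⁻¹ * b := by
      rw [map_inv, hc]; simp
    exact congrArg Units.val this

end DoubleCoset

section Count

variable {E : Type} [Field E] {d : ℕ}

lemma isUnit_mk_iff_coeff_zero_ne_zero (hd : 1 ≤ d) (p : Polynomial E) :
    IsUnit (Ideal.Quotient.mk (Ideal.span {(Polynomial.X : Polynomial E) ^ d}) p) ↔
      p.coeff 0 ≠ 0 := by
  rw [Ne, ← Polynomial.X_dvd_iff, ← Polynomial.irreducible_X.coprime_iff_not_dvd,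
    ← IsCoprime.pow_left_iff (m := d) (by omega)]
  constructor
  · intro h
    obtain ⟨y, hy⟩ := h.exists_right_inv
    obtain ⟨y, rfl⟩ := Ideal.Quotient.mk_surjective y
    rw [← map_mul, ← map_one (Ideal.Quotient.mk _), Ideal.Quotient.eq,
      Ideal.mem_span_singleton] at hy
    obtain ⟨c, hc⟩ := hy
    exact ⟨-c, y, by linear_combination hc⟩
  · rintro ⟨a, b, hab⟩
    refine .of_mul_eq_one (Ideal.Quotient.mk _ b) ?_
    rw [← map_mul, ← map_one (Ideal.Quotient.mk _), Ideal.Quotient.eq, Ideal.mem_span_singleton]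
    exact ⟨-a, by linear_combination hab⟩

/-- Reduction of `E[X]/(X^d)` onto its residue field. -/
noncomputable def QRing.evalZero (hd : 1 ≤ d) : QRing E d →+* E :=
  Ideal.Quotient.lift _ Polynomial.constantCoeff fun p hp => by
    obtain ⟨c, rfl⟩ := Ideal.mem_span_singleton.1 hp
    simp [show 0 ≠ d by omega]

lemma QRing.isUnit_iff_evalZero_ne_zero (hd : 1 ≤ d) (x : QRing E d) :
    IsUnit x ↔ QRing.evalZero hd x ≠ 0 := by
  obtain ⟨p, rfl⟩ := Ideal.Quotient.mk_surjective x
  exact isUnit_mk_iff_coeff_zero_ne_zero hd p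

lemma QRing.evalZero_surjective (hd : 1 ≤ d) :
    Function.Surjective (QRing.evalZero hd : QRing E d →+* E) := fun e =>
  ⟨Ideal.Quotient.mk _ (Polynomial.C e), by simp [QRing.evalZero]⟩

lemma QRing.natCard [Finite E] : Nat.card (QRing E d) = Nat.card E ^ d := by
  have : Module.Finite E (QRing E d) := (Polynomial.monic_X_pow d).finite_quotient
  rw [Module.natCard_eq_pow_finrank (K := E), finrank_quotient_span_eq_natDegree,
    Polynomial.natDegree_X_pow]

lemma QRing.natCard_units [Finite E] (hd : 1 ≤ d) :
    Nat.card (QRing E d)ˣ = (Nat.card E - 1) * Nat.card E ^ (d - 1) := by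
  have hpos : 0 < Nat.card E := Nat.card_pos
  have : Finite (QRing E d) := Nat.finite_of_card_ne_zero (by rw [QRing.natCard]; positivity)
  set φ : QRing E d →+* E := QRing.evalZero hd
  have hker : Nat.card E * Nat.card φ.toAddMonoidHom.ker = Nat.card E ^ d := by
    rw [← QRing.natCard, AddSubgroup.card_eq_card_quotient_mul_card_addSubgroup
      φ.toAddMonoidHom.ker, Nat.card_congr (QuotientAddGroup.quotientKerEquivOfSurjective
      φ.toAddMonoidHom (QRing.evalZero_surjective hd)).toEquiv]
  have hker' : Nat.card φ.toAddMonoidHom.ker = Nat.card E ^ (d - 1) := by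
    refine Nat.eq_of_mul_eq_mul_left hpos ?_
    rw [hker, ← pow_succ', Nat.sub_add_cancel hd]
  have hunits : Nat.card (QRing E d)ˣ = ((φ.toAddMonoidHom.ker : Set (QRing E d))ᶜ).ncard := by
    rw [← Set.ncard_range_of_injective (Units.val_injective (α := QRing E d))]
    congr 1
    ext x
    exact QRing.isUnit_iff_evalZero_ne_zero hd x
  have hsum := Set.ncard_add_ncard_compl (φ.toAddMonoidHom.ker : Set (QRing E d))
  rw [← hunits, ← Nat.card_coe_set_eq, QRing.natCard] at hsum
  change Nat.card φ.toAddMonoidHom.ker + _ = _ at hsum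
  rw [Nat.sub_mul, one_mul, ← pow_succ', Nat.sub_add_cancel hd]
  omega

end Count

/-- Over `R = E[X]/(X^d)` with `|F| = q`, `|E| = q^r`, the number of
double cosets `Z·U·g·T_F·U` in `GL₂(R)` containing a matrix with unit `(2,1)`-entry is
`(q^r − 1)·q^{r(d−1)}/(q − 1)`; the map `a ↦ [Z·U·w(a)·T_F·U]` induces a bijection from
`R^×/F^×` onto this set, and `|R^×/F^×| = (q^r − 1)·q^{r(d−1)}/(q − 1)`. -/
theorem stmt_14 {F E : Type} [Field F] [Field E] [Algebra F E]
    [Fintype F] [Fintype E] (q r d : ℕ)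
    (hq : Fintype.card F = q) (hE : Fintype.card E = q ^ r) (hd : 1 ≤ d)
    (f : F →+* QRing E d)
    (hf : f = (Ideal.Quotient.mk (Ideal.span {(Polynomial.X : Polynomial E) ^ d})).comp
      (Polynomial.C.comp (algebraMap F E)))
    (Z U TF : Set (Matrix (Fin 2) (Fin 2) (QRing E d)))
    (hZ : Z = {M | ∃ x : (QRing E d)ˣ,
      M = !![(x : QRing E d), 0; 0, (x : QRing E d)]})
    (hU : U = {M | ∃ u : QRing E d, M = !![1, u; 0, 1]})
    (hTF : TF = {M | ∃ p s : Fˣ, M = !![f (p : F), 0; 0, f (s : F)]})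
    (w : (QRing E d)ˣ → Matrix (Fin 2) (Fin 2) (QRing E d))
    (hw : ∀ a : (QRing E d)ˣ, w a = !![0, (a : QRing E d); 1, 0])
    (Dc : Matrix (Fin 2) (Fin 2) (QRing E d) → Set (Matrix (Fin 2) (Fin 2) (QRing E d)))
    (hDc : ∀ g, Dc g = {M | ∃ z ∈ Z, ∃ u ∈ U, ∃ t ∈ TF, ∃ u' ∈ U, M = z * u * g * t * u'}) :
    -- the count of double cosets meeting the unit-(2,1)-entry locus
    (Set.ncard {S : Set (Matrix (Fin 2) (Fin 2) (QRing E d)) |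
        ∃ g : Matrix (Fin 2) (Fin 2) (QRing E d),
          IsUnit g ∧ S = Dc g ∧ ∃ m ∈ S, IsUnit (m 1 0)}
      = (q ^ r - 1) * q ^ (r * (d - 1)) / (q - 1)) ∧
    -- a ↦ [double coset of w(a)] induces a bijection from R^×/F^× onto this set
    (∀ a b : (QRing E d)ˣ,
      Dc (w a) = Dc (w b) ↔ ∃ c : Fˣ, (a : QRing E d) = f (c : F) * (b : QRing E d)) ∧
    (∀ S : Set (Matrix (Fin 2) (Fin 2) (QRing E d)),
      (∃ g : Matrix (Fin 2) (Fin 2) (QRing E d),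
          IsUnit g ∧ S = Dc g ∧ ∃ m ∈ S, IsUnit (m 1 0)) →
      ∃ a : (QRing E d)ˣ, S = Dc (w a)) ∧
    -- |R^×/F^×| = (q^r − 1)·q^{r(d−1)}/(q − 1)
    (Nat.card ((QRing E d)ˣ ⧸ (Units.map f.toMonoidHom).range)
      = (q ^ r - 1) * q ^ (r * (d - 1)) / (q - 1)) := by
  obtain rfl : Dc = borelDoubleCoset f := by
    funext g
    rw [hDc, hZ, hU, hTF, borelDoubleCoset]
  obtain rfl : w = fun a : (QRing E d)ˣ => !![0, (a : QRing E d); 1, 0] := funext hw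
  have hcard : Nat.card ((QRing E d)ˣ ⧸ (Units.map f.toMonoidHom).range) =
      (q ^ r - 1) * q ^ (r * (d - 1)) / (q - 1) := by
    have hX : (Ideal.Quotient.mk (Ideal.span {(Polynomial.X : Polynomial E) ^ d})) 0 ≠ 1 := by
      intro h
      have := (isUnit_mk_iff_coeff_zero_ne_zero hd (0 : Polynomial E)).1 (h ▸ isUnit_one)
      simp at this
    have : Nontrivial (QRing E d) := ⟨⟨_, _, hX⟩⟩
    have hrange : Nat.card (Units.map f.toMonoidHom).range = q - 1 := by
      rw [← Nat.card_congr (MonoidHom.ofInjective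
        (Units.map_injective (f := f.toMonoidHom) f.injective)).toEquiv,
        Nat.card_units, Nat.card_eq_fintype_card, hq]
    have h := Subgroup.card_eq_card_quotient_mul_card_subgroup (Units.map f.toMonoidHom).range
    rw [QRing.natCard_units hd, hrange, Nat.card_eq_fintype_card (α := E), hE, ← pow_mul] at h
    have hq1 : 1 < q := hq ▸ Fintype.one_lt_card
    exact (Nat.div_eq_of_eq_mul_left (by omega) h).symm
  refine ⟨ncard_setOf_borelDoubleCoset.trans hcard, borelDoubleCoset_antidiagonal_eq_iff, ?_,
    hcard⟩
  intro S hS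
  obtain ⟨a, ha⟩ := setOf_borelDoubleCoset_eq_range.subset hS
  exact ⟨a, ha.symm⟩
end
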